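/- arXiv:2507.20416 — 2 statements merged into one kernel-verified Lean document; each statement's English description precedes it below -/
import Mathlib

section
/- Let α and β be two irrational real numbers such that neither α + β nor α − β is an integer. Then the difference ψ_α(t) − ψ_β(t) changes its sign infinitely many times as t → +∞; that is, for every T > 0 there exist t₁, t₂ > T with ψ_α(t₁) − ψ_β(t₁) > 0 and ψ_α(t₂) − ψ_β(t₂) < 0. -/
/-- Distance from `x` to the nearest integer. -/
noncomputable def distToInt (x : ℝ) : ℝ := |x - round x|

/-- The irrationality measure function `ψ_α(t) = min_{1 ≤ q ≤ t} ‖qα‖`. -/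
noncomputable def psi (α : ℝ) (t : ℝ) : ℝ :=
  sInf ((fun q : ℤ => distToInt ((q : ℝ) * α)) '' {q : ℤ | 1 ≤ q ∧ (q : ℝ) ≤ t})

/-- An `n`-tuple is pairwise independent if eventually all the values
`ψ_{α_i}(t)` are pairwise distinct. -/
def PairwiseIndependent {n : ℕ} (α : Fin n → ℝ) : Prop :=
  ∃ T : ℝ, 0 ≤ T ∧ ∀ t : ℝ, T ≤ t → ∀ i j : Fin n, i ≠ j → psi (α i) t ≠ psi (α j) t

/-- `v : Fin n → Fin n` is the order vector of `α` at time `t`: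
`ψ_{α_{v 0}}(t) > ψ_{α_{v 1}}(t) > … > ψ_{α_{v (n-1)}}(t)`. -/
def IsOrderVec {n : ℕ} (α : Fin n → ℝ) (t : ℝ) (v : Fin n → Fin n) : Prop :=
  Function.Bijective v ∧
    ∀ p q : Fin n, p < q → psi (α (v p)) t > psi (α (v q)) t

/-- The order vector `v` occurs at arbitrarily large times. -/
def OccursInfinitely {n : ℕ} (α : Fin n → ℝ) (v : Fin n → Fin n) : Prop :=
  ∀ T : ℝ, ∃ t : ℝ, T < t ∧ IsOrderVec α t v

/-- `k(α)`: the number of distinct order vectors occurring for arbitrarily large `t`. -/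
noncomputable def kAlpha {n : ℕ} (α : Fin n → ℝ) : ℕ :=
  Nat.card {v : Fin n → Fin n | OccursInfinitely α v}

/-- The relative order of the functions `ψ_{α_i}` is the same at times `t` and `t'`
(i.e. the order vectors coincide). -/
def SameOrder {n : ℕ} (α : Fin n → ℝ) (t t' : ℝ) : Prop :=
  ∀ i j : Fin n, (psi (α i) t < psi (α j) t ↔ psi (α i) t' < psi (α j) t')

/-- `ts` is a sequence of moments of permutation changes:
`ts (i+1) = min { t > ts i : v_α(t) ≠ v_α(ts i) }`. -/
def IsChangeSeq {n : ℕ} (α : Fin n → ℝ) (ts : ℕ → ℝ) : Prop :=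
  ∀ i : ℕ, IsLeast {t : ℝ | ts i < t ∧ ¬ SameOrder α (ts i) t} (ts (i + 1))

/-- The set of positions `(j,l)`, `1 ≤ j ≤ l ≤ k` (here `0`-based). -/
def PairIdx (k : ℕ) := {p : Fin k × Fin k // p.1 ≤ p.2}

/-- Construct a position from `0`-based indices `j ≤ l < k`. -/
def mkPos {k : ℕ} (j l : ℕ) (hj : j ≤ l) (hl : l < k) : PairIdx k :=
  ⟨(⟨j, lt_of_le_of_lt hj hl⟩, ⟨l, hl⟩), Fin.mk_le_mk.mpr hj⟩

/-- The position permutation underlying `π`: one has `π(u) = u ∘ tau`.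
In `1`-based notation: `tau (i,i) = (i+1,i+1)` for `i < k`, `tau (k,k) = (1,1)`,
`tau (i,k) = (1,i+1)` for `i < k`, and `tau (i,j) = (i+1,j+1)` otherwise. -/
def tau {k : ℕ} (p : PairIdx k) : PairIdx k :=
  if h2 : p.1.2.val = k - 1 then
    if h1 : p.1.1.val = k - 1 then
      ⟨(⟨0, by have := p.1.2.isLt; omega⟩, ⟨0, by have := p.1.2.isLt; omega⟩), le_refl _⟩
    else
      ⟨(⟨0, by have := p.1.2.isLt; omega⟩,
        ⟨p.1.1.val + 1, by have := p.1.1.isLt; omega⟩),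
       Fin.mk_le_mk.mpr (by omega)⟩
  else
    ⟨(⟨p.1.1.val + 1, by have h := p.1.2.isLt; have h' : p.1.1.val ≤ p.1.2.val := p.2; omega⟩,
      ⟨p.1.2.val + 1, by have h := p.1.2.isLt; omega⟩),
     Fin.mk_le_mk.mpr (by have h' : p.1.1.val ≤ p.1.2.val := p.2; omega)⟩

/-- The action of `π` on vectors indexed by positions: `π(u) = u ∘ tau`. -/
def piMap {k : ℕ} {X : Type*} (u : PairIdx k → X) : PairIdx k → X :=
  fun p => u (tau p)

/-- The (`0`-based) linear position of the pair `(j,l)` in the special enumeration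
`u_{1,1}, u_{1,k}, u_{1,k-1}, …, u_{1,2}, u_{2,2}, u_{2,k}, …, u_{k,k}`. -/
def posIdx {k : ℕ} (p : PairIdx k) : ℕ :=
  (p.1.1.val * k - p.1.1.val * (p.1.1.val - 1) / 2) +
    (if p.1.2.val = p.1.1.val then 0 else k - p.1.2.val)

/-- `v : PairIdx k → Fin n` is the order vector of `α` at time `t`, written in the
special pair enumeration: the function at position `p` is larger than the one at
position `q` whenever `p` precedes `q` in the enumeration. -/
def IsOrderVecP {n k : ℕ} (α : Fin n → ℝ) (t : ℝ) (v : PairIdx k → Fin n) : Prop :=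
  Function.Bijective v ∧
    ∀ p q : PairIdx k, posIdx p < posIdx q → psi (α (v p)) t > psi (α (v q)) t

/-- Denominator `q_m` of the `m`-th convergent of the continued fraction of `α`. -/
noncomputable def cfDen (α : ℝ) (m : ℕ) : ℝ := (GenContFract.of α).dens m

/-- The orbit equivalence relation of the map `tau` on positions. -/
def orbitSetoid (k : ℕ) : Setoid (PairIdx k) where
  r p q := ∃ a b : ℕ, (fun x : PairIdx k => tau x)^[a] p = (fun x : PairIdx k => tau x)^[b] q
  iseqv := by
    constructor
    · exact fun p => ⟨0, 0, rfl⟩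
    · rintro p q ⟨a, b, h⟩; exact ⟨b, a, h.symm⟩
    · rintro p q r ⟨a, b, h1⟩ ⟨c, d, h2⟩
      refine ⟨c + a, b + d, ?_⟩
      rw [Function.iterate_add_apply, h1, ← Function.iterate_add_apply,
        Nat.add_comm c b, Function.iterate_add_apply, h2, ← Function.iterate_add_apply]

/-- The signed distance from `q * α` to the nearest integer. -/
noncomputable def residue (α : ℝ) (q : ℤ) : ℝ := (q : ℝ) * α - round ((q : ℝ) * α)

/-- `q < q'` are consecutive denominators of best approximations to `α`. -/
structure IsConsecutiveBest (α : ℝ) (q q' : ℤ) : Prop where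
  pos : 1 ≤ q
  lt : q < q'
  le_of_lt : ∀ r, 1 ≤ r → r < q' → |residue α q| ≤ |residue α r|
  residue_lt : |residue α q'| < |residue α q|

theorem abs_residue_le (α : ℝ) (q p : ℤ) : |residue α q| ≤ |(q : ℝ) * α - p| :=
  round_le _ p

theorem residue_ne_zero {α : ℝ} (hα : Irrational α) {q : ℤ} (hq : 1 ≤ q) : residue α q ≠ 0 :=
  sub_ne_zero.mpr ((hα.intCast_mul (by omega)).ne_int _)

theorem exists_abs_residue_lt {α : ℝ} {ε : ℝ} (hε : 0 < ε) :
    ∃ q : ℤ, 1 ≤ q ∧ |residue α q| < ε := by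
  obtain ⟨n, hn⟩ := exists_nat_one_div_lt hε
  obtain ⟨j, k, hk, -, h⟩ := Real.exists_int_int_abs_mul_sub_le α n.succ_pos
  refine ⟨k, hk, (abs_residue_le α k j).trans_lt (h.trans_lt (lt_of_le_of_lt ?_ hn))⟩
  push_cast
  gcongr
  linarith

theorem abs_residue_sub_le (α : ℝ) (q r : ℤ) :
    |residue α (q - r)| ≤ |residue α q - residue α r| := by
  refine (abs_residue_le α (q - r) (round ((q : ℝ) * α) - round ((r : ℝ) * α))).trans_eq ?_
  unfold residue
  push_cast
  congr 1
  ring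

/-- The minimum over `[1, N]` of the distances of multiples of `α` to the integers. -/
theorem exists_abs_residue_min (α : ℝ) {N : ℤ} (hN : 1 ≤ N) :
    ∃ q, 1 ≤ q ∧ q ≤ N ∧ ∀ r, 1 ≤ r → r ≤ N → |residue α q| ≤ |residue α r| := by
  obtain ⟨q, hq, hmin⟩ := Set.exists_min_image (Set.Icc 1 N) (fun r => |residue α r|)
    (Set.finite_Icc 1 N) ⟨1, by simp [hN]⟩
  exact ⟨q, hq.1, hq.2, fun r h1 h2 => hmin r ⟨h1, h2⟩⟩

theorem exists_isConsecutiveBest {α : ℝ} (hα : Irrational α) {N : ℤ} (hN : 1 ≤ N) :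
    ∃ q q', q ≤ N ∧ N < q' ∧ IsConsecutiveBest α q q' := by
  obtain ⟨q, hq, hqN, hmin⟩ := exists_abs_residue_min α hN
  obtain ⟨q', ⟨h1, h2⟩, h3⟩ := Int.exists_least_of_bdd
    (P := fun r => 1 ≤ r ∧ |residue α r| < |residue α q|) ⟨1, fun z hz => hz.1⟩
    (exists_abs_residue_lt (abs_pos.mpr (residue_ne_zero hα hq)))
  have hlt : N < q' := by
    by_contra! h
    exact (hmin q' h1 h).not_gt h2
  refine ⟨q, q', hqN, hlt, hq, hqN.trans_lt hlt, fun r hr hrq => ?_, h2⟩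
  by_contra! h
  exact (h3 r ⟨hr, h⟩).not_gt hrq

namespace IsConsecutiveBest

variable {α : ℝ} {q q' r r' : ℤ}

theorem residue_lt_of_lt (h : IsConsecutiveBest α q q') (hr : 1 ≤ r) (hrq : r < q') :
    |residue α q'| < |residue α r| :=
  h.residue_lt.trans_le (h.le_of_lt r hr hrq)

/-- A best approximation denominator below `r'` is at most `r`, if `r < r'` are consecutive. -/
theorem le_left (h : IsConsecutiveBest α q q') (h' : IsConsecutiveBest α r r') (hlt : q' < r') :
    q' ≤ r := by
  by_contra! hr
  exact (h.residue_lt_of_lt h'.pos hr).not_ge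
    (h'.le_of_lt q' (by linarith [h.pos, h.lt]) hlt)

theorem mul_residue_neg (hα : Irrational α) (h : IsConsecutiveBest α q q') :
    residue α q * residue α q' < 0 := by
  have h0 := residue_ne_zero hα h.pos
  have h0' := residue_ne_zero hα (h.pos.trans h.lt.le)
  by_contra! hs
  have hle := (h.le_of_lt (q' - q) (by linarith [h.lt]) (by linarith [h.pos])).trans
    (abs_residue_sub_le α q' q)
  have hlt := h.residue_lt
  rcases lt_or_gt_of_ne h0 with h1 | h1 <;> rcases lt_or_gt_of_ne h0' with h2 | h2
  · rw [abs_of_neg h1, abs_of_neg h2] at hlt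
    rw [abs_of_neg h1, abs_of_pos (by linarith)] at hle
    linarith
  · nlinarith
  · nlinarith
  · rw [abs_of_pos h1, abs_of_pos h2] at hlt
    rw [abs_of_pos h1, abs_of_neg (by linarith)] at hle
    linarith

theorem mul_abs_residue_le_one (h : IsConsecutiveBest α q q') : (q' : ℝ) * |residue α q| ≤ 1 := by
  have hq := h.pos
  have hq' := h.lt
  obtain ⟨j, k, hk, hkn, hle⟩ := Real.exists_int_int_abs_mul_sub_le α
    (n := (q' - 1).toNat) (by omega)
  have hcast : (((q' - 1).toNat : ℕ) : ℝ) = q' - 1 := by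
    have : (((q' - 1).toNat : ℤ) : ℝ) = ((q' - 1 : ℤ) : ℝ) := by
      rw [Int.toNat_of_nonneg (by omega)]
    push_cast at this
    exact_mod_cast this
  have hpos : (0 : ℝ) < q' := by exact_mod_cast (by omega : 0 < q')
  rw [hcast, sub_add_cancel, le_div_iff₀ hpos] at hle
  have := (h.le_of_lt k hk (by omega)).trans (abs_residue_le α k j)
  nlinarith

theorem abs_det_eq (hα : Irrational α) (h : IsConsecutiveBest α q q') :
    |(q' : ℝ) * residue α q - q * residue α q'| =
      q' * |residue α q| + q * |residue α q'| := by
  have hq : (0 : ℝ) < q := by exact_mod_cast h.pos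
  have hq' : (0 : ℝ) < q' := hq.trans (by exact_mod_cast h.lt)
  rcases mul_neg_iff.mp (h.mul_residue_neg hα) with ⟨h1, h2⟩ | ⟨h1, h2⟩
  · rw [abs_of_pos h1, abs_of_neg h2, abs_of_pos (by nlinarith)]
    ring
  · rw [abs_of_neg h1, abs_of_pos h2, abs_of_neg (by nlinarith)]
    ring

theorem det_cast (α : ℝ) (q q' : ℤ) :
    ((q * round ((q' : ℝ) * α) - q' * round ((q : ℝ) * α) : ℤ) : ℝ) =
      q' * residue α q - q * residue α q' := by
  unfold residue
  push_cast
  ring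

theorem abs_det (hα : Irrational α) (h : IsConsecutiveBest α q q') :
    |q * round ((q' : ℝ) * α) - q' * round ((q : ℝ) * α)| = 1 := by
  have hq : (0 : ℝ) < q := by exact_mod_cast h.pos
  have hlt : (q : ℝ) < q' := by exact_mod_cast h.lt
  have hD := h.abs_det_eq hα
  rw [← det_cast, ← Int.cast_abs] at hD
  have h1 := h.mul_abs_residue_le_one
  have h2 := h.residue_lt
  have h3 := abs_pos.mpr (residue_ne_zero hα h.pos)
  have h4 := abs_nonneg (residue α q')
  have hlo : (0 : ℝ) < ((|q * round ((q' : ℝ) * α) - q' * round ((q : ℝ) * α)| : ℤ) : ℝ) := by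
    rw [hD]
    nlinarith
  have hhi : ((|q * round ((q' : ℝ) * α) - q' * round ((q : ℝ) * α)| : ℤ) : ℝ) < 2 := by
    rw [hD]
    nlinarith
  have hlo' := Int.cast_pos.mp hlo
  have hhi' : |q * round ((q' : ℝ) * α) - q' * round ((q : ℝ) * α)| < 2 := by exact_mod_cast hhi
  omega

theorem mul_add_mul_eq_one (hα : Irrational α) (h : IsConsecutiveBest α q q') :
    (q' : ℝ) * |residue α q| + q * |residue α q'| = 1 := by
  rw [← h.abs_det_eq hα, ← det_cast, ← Int.cast_abs, h.abs_det hα, Int.cast_one]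

theorem exists_next (hα : Irrational α) (h : IsConsecutiveBest α q q') :
    ∃ q'', IsConsecutiveBest α q' q'' := by
  obtain ⟨r, r', hr, hr', hc⟩ := exists_isConsecutiveBest hα (h.pos.trans h.lt.le)
  have := h.le_left hc hr'
  obtain rfl : r = q' := le_antisymm hr this
  exact ⟨r', hc⟩

theorem add_le {q'' : ℤ} (hα : Irrational α) (h : IsConsecutiveBest α q q')
    (h' : IsConsecutiveBest α q' q'') : q + q' ≤ q'' := by
  by_contra! hlt
  have hle := (h.le_of_lt (q'' - q) (by linarith [h.lt, h'.lt]) (by linarith)).trans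
    (abs_residue_sub_le α q'' q)
  have hd := h.residue_lt
  have hd' := h'.residue_lt
  rcases mul_neg_iff.mp (h.mul_residue_neg hα) with ⟨h1, h2⟩ | ⟨h1, h2⟩ <;>
    rcases mul_neg_iff.mp (h'.mul_residue_neg hα) with ⟨h3, h4⟩ | ⟨h3, h4⟩
  · linarith
  · rw [abs_of_pos h1, abs_of_neg h2] at hd
    rw [abs_of_neg h2, abs_of_pos h4] at hd'
    rw [abs_of_pos h1, abs_of_neg (by linarith)] at hle
    linarith
  · rw [abs_of_neg h1, abs_of_pos h2] at hd
    rw [abs_of_pos h2, abs_of_neg h4] at hd'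
    rw [abs_of_neg h1, abs_of_pos (by linarith)] at hle
    linarith
  · linarith

end IsConsecutiveBest

theorem psi_le (α : ℝ) {N r : ℤ} (hr : 1 ≤ r) (hrN : r ≤ N) : psi α N ≤ |residue α r| :=
  csInf_le ⟨0, by rintro _ ⟨q, -, rfl⟩; exact abs_nonneg _⟩
    ⟨r, ⟨hr, by exact_mod_cast hrN⟩, rfl⟩

theorem exists_abs_residue_le_psi (α : ℝ) {N : ℤ} (hN : 1 ≤ N) :
    ∃ q, 1 ≤ q ∧ q ≤ N ∧ |residue α q| ≤ psi α N := by
  obtain ⟨q, hq, hqN, hmin⟩ := exists_abs_residue_min α hN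
  refine ⟨q, hq, hqN, le_csInf ⟨_, 1, ⟨le_rfl, by exact_mod_cast hN⟩, rfl⟩ ?_⟩
  rintro _ ⟨r, ⟨hr, hrN⟩, rfl⟩
  exact hmin r hr (by exact_mod_cast hrN)

theorem IsConsecutiveBest.le_of_psi_le {α β : ℝ} {q q' N r : ℤ} (h : IsConsecutiveBest α q q')
    (hpsi : psi α N ≤ psi β N) (hN : N < q') (hr : 1 ≤ r) (hrN : r ≤ N) :
    |residue α q| ≤ |residue β r| := by
  obtain ⟨k, hk, hkN, hle⟩ := exists_abs_residue_le_psi α (hr.trans hrN)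
  exact (h.le_of_lt k hk (hkN.trans_lt hN)).trans (hle.trans (hpsi.trans (psi_le β hr hrN)))

/-- If `ψ_α ≤ ψ_β` from `T` on, a gap of `β` starting beyond `T` has no denominator of `α`
in its interior. -/
theorem IsConsecutiveBest.right_le_of_psi_le {α β : ℝ} (hα : Irrational α) (hβ : Irrational β)
    {T : ℤ} (hpsi : ∀ N : ℤ, T ≤ N → psi α N ≤ psi β N) {x y s s' : ℤ}
    (h : IsConsecutiveBest α x y) (h' : IsConsecutiveBest β s s') (hT : T ≤ s)
    (hxs : x ≤ s) (hsy : s < y) : s' ≤ y := by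
  by_contra! hy
  obtain ⟨z, hz⟩ := h.exists_next hα
  have hle := h.le_of_psi_le (hpsi s hT) hsy h'.pos le_rfl
  have e := h.mul_add_mul_eq_one hα
  have e' := h'.mul_add_mul_eq_one hβ
  have hx : (1 : ℝ) ≤ x := by exact_mod_cast h.pos
  have hxs' : (x : ℝ) ≤ s := by exact_mod_cast hxs
  have hxy : (x : ℝ) < y := by exact_mod_cast h.lt
  have hy' : (y : ℝ) < s' := by exact_mod_cast hy
  have hβs := abs_pos.mpr (residue_ne_zero hβ h'.pos)
  have hβs' := abs_pos.mpr (residue_ne_zero hβ (h'.pos.trans h'.lt.le))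
  have hzs : z ≤ s' := by
    by_contra! hlt
    have hle' := hz.le_of_psi_le (hpsi s' (hT.trans h'.lt.le)) hlt (h'.pos.trans h'.lt.le) le_rfl
    have h1 : (y : ℝ) * |residue α x| ≤ y * |residue β s| := by gcongr; linarith
    have h2 : (y : ℝ) * |residue β s| < s' * |residue β s| := by gcongr
    have h3 : (x : ℝ) * |residue α y| ≤ s * |residue β s'| := by gcongr; linarith
    linarith
  have hsum : (x : ℝ) + y ≤ s' := by exact_mod_cast (h.add_le hα hz).trans hzs
  have h1 : (x : ℝ) * |residue α y| < x * |residue α x| := by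
    have := h.residue_lt
    gcongr
  have h2 : ((x : ℝ) + y) * |residue α x| ≤ s' * |residue β s| := by gcongr; linarith
  have h3 : 0 < (s : ℝ) * |residue β s'| := by
    have : (0 : ℝ) < s := by linarith
    positivity
  linarith

/-- If `ψ_α ≤ ψ_β` from `T` on, large denominators of `α` are denominators of `β`. -/
theorem exists_isConsecutiveBest_of_psi_le {α β : ℝ} (hα : Irrational α) (hβ : Irrational β)
    {T : ℤ} (hpsi : ∀ N : ℤ, T ≤ N → psi α N ≤ psi β N) {b b' q q' : ℤ}
    (hb : IsConsecutiveBest β b b') (hT : T ≤ b') (hq : IsConsecutiveBest α q q') (hbq : b' < q') :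
    ∃ s, IsConsecutiveBest β s q' := by
  obtain ⟨s, s', hs, hs', hc⟩ := exists_isConsecutiveBest hβ (N := q' - 1)
    (by linarith [hq.pos, hq.lt])
  have hbs : b' ≤ s := hb.le_left hc (by omega)
  obtain ⟨x, y, hx, hy, hxy⟩ := exists_isConsecutiveBest hα hc.pos
  have hle := hxy.right_le_of_psi_le hα hβ hpsi hc (hT.trans hbs) hx hy
  have hyq : y ≤ q' := by
    by_contra! hlt
    have := hq.le_left hxy hlt
    omega
  obtain rfl : s' = q' := by omega
  exact ⟨s, hc⟩

theorem exists_int_eq_of_mul_eq {q q' p p' m n : ℤ} {x : ℝ} (hdet : |q * p' - q' * p| = 1)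
    (hm : (q : ℝ) * x = m) (hn : (q' : ℝ) * x = n) : ∃ z : ℤ, x = z := by
  have key : ((q * p' - q' * p : ℤ) : ℝ) * x = ((m * p' - n * p : ℤ) : ℝ) := by
    push_cast
    linear_combination (p' : ℝ) * hm - (p : ℝ) * hn
  rcases eq_or_eq_neg_of_abs_eq hdet with h | h <;> rw [h] at key
  · exact ⟨m * p' - n * p, by simpa using key⟩
  · refine ⟨-(m * p' - n * p), ?_⟩
    push_cast at key ⊢
    linarith

theorem exists_psi_lt {α β : ℝ} (hα : Irrational α) (hβ : Irrational β)
    (hsum : ∀ z : ℤ, α + β ≠ (z : ℝ)) (hdiff : ∀ z : ℤ, α - β ≠ (z : ℝ)) (T : ℝ) :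
    ∃ t : ℝ, T < t ∧ psi β t < psi α t := by
  by_contra! hpsi
  obtain ⟨M, hM⟩ := exists_int_gt T
  have hpsi' : ∀ N : ℤ, M ≤ N → psi α N ≤ psi β N := fun N hN =>
    hpsi N (hM.trans_le (by exact_mod_cast hN))
  obtain ⟨b, b', -, hMb, hb⟩ := exists_isConsecutiveBest hβ (le_max_right M 1)
  have hMb' : M ≤ b' := (le_max_left M 1).trans hMb.le
  obtain ⟨a, q, -, hbq, haq⟩ := exists_isConsecutiveBest hα (hb.pos.trans hb.lt.le)
  obtain ⟨q', hq⟩ := haq.exists_next hα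
  obtain ⟨z, hz⟩ := hq.exists_next hα
  obtain ⟨r, hr⟩ := exists_isConsecutiveBest_of_psi_le hα hβ hpsi' hb hMb' haq hbq
  obtain ⟨s, hs⟩ := exists_isConsecutiveBest_of_psi_le hα hβ hpsi' hb hMb' hq (hbq.trans hq.lt)
  have hqs : q ≤ s := hr.le_left hs hq.lt
  have hle : |residue α q| ≤ |residue β s| :=
    hq.le_of_psi_le (hpsi' s (by linarith)) hs.lt hs.pos le_rfl
  have hle' : |residue α q'| ≤ |residue β q'| :=
    hz.le_of_psi_le (hpsi' q' (by linarith [hq.lt])) hz.lt hz.pos le_rfl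
  have e := hq.mul_add_mul_eq_one hα
  have e' := hs.mul_add_mul_eq_one hβ
  have hq0 : (0 : ℝ) < q := by exact_mod_cast hq.pos
  have hq0' : (0 : ℝ) < q' := by exact_mod_cast hz.pos
  have hqs' : (q : ℝ) ≤ s := by exact_mod_cast hqs
  have hpos := abs_pos.mpr (residue_ne_zero hβ hz.pos)
  have h1 : (q' : ℝ) * |residue α q| ≤ q' * |residue β s| := by gcongr
  have h2 : (q : ℝ) * |residue α q'| ≤ q * |residue β q'| := by gcongr
  have h3 : (q : ℝ) * |residue β q'| ≤ s * |residue β q'| := by gcongr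
  have hsq : (s : ℝ) = q := mul_right_cancel₀ hpos.ne' (by linarith)
  obtain rfl : s = q := by exact_mod_cast hsq
  have a1 : |residue α s| = |residue β s| := mul_left_cancel₀ hq0'.ne' (by linarith)
  have a2 : |residue α q'| = |residue β q'| := mul_left_cancel₀ hq0.ne' (by linarith)
  have hdet := hq.abs_det hα
  have n1 := hq.mul_residue_neg hα
  have n2 := hs.mul_residue_neg hβ
  rcases abs_eq_abs.mp a1 with b1 | b1 <;> rcases abs_eq_abs.mp a2 with b2 | b2
  · obtain ⟨z, hz⟩ := exists_int_eq_of_mul_eq (x := α - β)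
      (m := round ((s : ℝ) * α) - round ((s : ℝ) * β))
      (n := round ((q' : ℝ) * α) - round ((q' : ℝ) * β)) hdet
      (by unfold residue at b1; push_cast; linarith)
      (by unfold residue at b2; push_cast; linarith)
    exact hdiff z hz
  · rw [b1, b2] at n1
    linarith
  · rw [b1, b2] at n1
    linarith
  · obtain ⟨z, hz⟩ := exists_int_eq_of_mul_eq (x := α + β)
      (m := round ((s : ℝ) * α) + round ((s : ℝ) * β))
      (n := round ((q' : ℝ) * α) + round ((q' : ℝ) * β)) hdet
      (by unfold residue at b1; push_cast; linarith)
      (by unfold residue at b2; push_cast; linarith)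
    exact hsum z hz

/-- **Kan–Moshchevitin.** For irrational `α, β` with `α ± β ∉ ℤ`, the difference
`ψ_α(t) - ψ_β(t)` changes sign infinitely often as `t → +∞`. -/
theorem stmt0 (α β : ℝ) (hα : Irrational α) (hβ : Irrational β)
    (hsum : ∀ z : ℤ, α + β ≠ (z : ℝ)) (hdiff : ∀ z : ℤ, α - β ≠ (z : ℝ)) :
    ∀ T : ℝ, 0 < T →
      (∃ t : ℝ, T < t ∧ 0 < psi α t - psi β t) ∧
      (∃ t : ℝ, T < t ∧ psi α t - psi β t < 0) := by
  intro T _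
  obtain ⟨t₁, h₁, h₁'⟩ := exists_psi_lt hα hβ hsum hdiff T
  obtain ⟨t₂, h₂, h₂'⟩ := exists_psi_lt hβ hα (fun z h => hsum z (by linarith))
    (fun z h => hdiff (-z) (by push_cast; linarith)) T
  exact ⟨⟨t₁, h₁, sub_pos.mpr h₁'⟩, t₂, h₂, sub_neg.mpr h₂'⟩
end

section
/- For every integer k ≥ 3 and n = k(k+1)/2, there exists an n-tuple α = (α_1, …, α_n) of pairwise independent irrational numbers with k(α) = k. -/
/-- A sequence of denominators: the first `2 * k` terms are Fermat numbers, the others are given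
by a recursion chosen so that the congruences of `IsDenominatorSeq` hold. -/
def denSeq (k : ℕ) (m : ℕ) : ℕ :=
  if h : 0 < k ∧ 2 * k ≤ m then
    denSeq k (m - k) + denSeq k (m - 2 * k) *
      (∏ d : Fin (k - 1), denSeq k (m - 1 - d)) ^ (3 * (denSeq k (m - k)).totient)
  else Nat.fermatNumber (2 * m + 1)
termination_by m
decreasing_by all_goals omega

theorem denSeq_of_lt {k m : ℕ} (h : m < 2 * k) : denSeq k m = Nat.fermatNumber (2 * m + 1) := by
  rw [denSeq, dif_neg (by omega)]

theorem denSeq_of_le {k m : ℕ} (hk : 0 < k) (h : 2 * k ≤ m) :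
    denSeq k m = denSeq k (m - k) + denSeq k (m - 2 * k) *
      (∏ d : Fin (k - 1), denSeq k (m - 1 - d)) ^ (3 * (denSeq k (m - k)).totient) := by
  rw [denSeq, dif_pos ⟨hk, h⟩]

theorem denSeq_dvd_prod {k m d : ℕ} (hd : 0 < d) (hdk : d < k) :
    denSeq k (m - d) ∣ ∏ d : Fin (k - 1), denSeq k (m - 1 - d) := by
  have h := Finset.dvd_prod_of_mem (fun d : Fin (k - 1) => denSeq k (m - 1 - d))
    (Finset.mem_univ ⟨d - 1, by omega⟩)
  simpa only [show m - 1 - (d - 1) = m - d by omega] using h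

theorem two_le_denSeq {k : ℕ} (hk : 0 < k) (m : ℕ) : 2 ≤ denSeq k m := by
  induction m using Nat.strong_induction_on with
  | _ m ih =>
    rcases lt_or_ge m (2 * k) with h | h
    · rw [denSeq_of_lt h]
      have := Nat.three_le_fermatNumber (2 * m + 1)
      omega
    · rw [denSeq_of_le hk h]
      exact (ih (m - k) (by omega)).trans (Nat.le_add_right _ _)

theorem denSeq_modEq_of_lt {k m d : ℕ} (h : 2 * k ≤ m) (hd : 0 < d) (hdk : d < k) :
    denSeq k m ≡ denSeq k (m - k) [MOD denSeq k (m - d)] := by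
  have hpos : 0 < (denSeq k (m - k)).totient :=
    Nat.totient_pos.2 (by have := two_le_denSeq (k := k) (by omega) (m - k); omega)
  rw [denSeq_of_le (by omega) h]
  have h0 : denSeq k (m - 2 * k) *
      (∏ d : Fin (k - 1), denSeq k (m - 1 - d)) ^ (3 * (denSeq k (m - k)).totient)
      ≡ 0 [MOD denSeq k (m - d)] := by
    rw [Nat.modEq_zero_iff_dvd]
    exact Dvd.dvd.mul_left ((denSeq_dvd_prod hd hdk).trans (dvd_pow_self _ (by omega))) _
  simpa using h0.add_left (denSeq k (m - k))

theorem denSeq_modEq_of_coprime {k m : ℕ} (hk : 0 < k) (h : 2 * k ≤ m)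
    (hc : ∀ d, 0 < d → d < k → Nat.Coprime (denSeq k (m - d)) (denSeq k (m - k))) :
    denSeq k m ≡ denSeq k (m - 2 * k) [MOD denSeq k (m - k)] := by
  have hP : Nat.Coprime (∏ d : Fin (k - 1), denSeq k (m - 1 - d)) (denSeq k (m - k)) := by
    refine Nat.Coprime.prod_left fun d _ => ?_
    have := hc (d + 1) (by omega) (by omega)
    rwa [show m - (d + 1) = m - 1 - (d : ℕ) by omega] at this
  have h1 := (Nat.ModEq.pow_totient hP).pow 3
  rw [← pow_mul, mul_comm _ 3, one_pow] at h1
  rw [denSeq_of_le hk h]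
  simpa using h1.mul_left (denSeq k (m - 2 * k))

theorem coprime_denSeq {k : ℕ} (m d : ℕ) (hd : 0 < d) (hdk : d ≤ k) (hdm : d ≤ m) :
    Nat.Coprime (denSeq k m) (denSeq k (m - d)) := by
  induction m using Nat.strong_induction_on generalizing d with
  | _ m ih =>
    rcases lt_or_ge m (2 * k) with h | h
    · rw [denSeq_of_lt h, denSeq_of_lt (by omega)]
      exact Nat.coprime_fermatNumber_fermatNumber (by omega)
    · have hc : ∀ d, 0 < d → d < k → Nat.Coprime (denSeq k (m - d)) (denSeq k (m - k)) := by
        intro d hd hdk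
        have := ih (m - d) (by omega) (k - d) (by omega) (by omega) (by omega)
        rwa [show m - d - (k - d) = m - k by omega] at this
      rcases hdk.lt_or_eq with hlt | rfl
      · have := (denSeq_modEq_of_lt h hd hlt).gcd_eq
        rw [Nat.Coprime, this]
        exact (hc d hd hlt).symm
      · have := (denSeq_modEq_of_coprime hd h hc).gcd_eq
        rw [Nat.Coprime, this, Nat.gcd_comm]
        have := ih (m - d) (by omega) d hd le_rfl (by omega)
        rwa [show m - d - d = m - 2 * d by omega] at this

theorem two_mul_sq_denSeq_le {k : ℕ} (hk : 2 ≤ k) (m : ℕ) :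
    2 * denSeq k m ^ 2 ≤ denSeq k (m + 1) := by
  rcases lt_or_ge (m + 1) (2 * k) with h | h
  · rw [denSeq_of_lt h, denSeq_of_lt (by omega), Nat.fermatNumber, Nat.fermatNumber]
    have h1 : 2 ^ (2 ^ (2 * (m + 1) + 1)) = (2 ^ (2 ^ (2 * m + 1))) ^ 4 := by
      rw [← pow_mul]; congr 1; ring
    have h2 : 4 ≤ 2 ^ (2 ^ (2 * m + 1)) := by
      calc 4 = 2 ^ 2 := by norm_num
        _ ≤ _ := Nat.pow_le_pow_right (by norm_num) (Nat.le_self_pow (by omega) 2)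
    rw [h1]
    generalize 2 ^ (2 ^ (2 * m + 1)) = x at h2
    nlinarith [Nat.mul_le_mul h2 h2, Nat.mul_le_mul h2 (Nat.mul_le_mul h2 h2),
      sq_nonneg x, Nat.mul_le_mul_right (x ^ 2) (Nat.mul_le_mul h2 h2)]
  · have hpos : 0 < (denSeq k (m + 1 - k)).totient :=
      Nat.totient_pos.2 (by have := two_le_denSeq (k := k) (by omega) (m + 1 - k); omega)
    have hP : denSeq k m ≤ ∏ d : Fin (k - 1), denSeq k (m + 1 - 1 - d) := by
      refine Nat.le_of_dvd (Finset.prod_pos fun d _ => ?_)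
        (denSeq_dvd_prod (m := m + 1) (d := 1) one_pos (by omega))
      have := two_le_denSeq (k := k) (by omega) (m + 1 - 1 - d)
      omega
    have h0 := two_le_denSeq (k := k) (by omega) m
    have h1 := two_le_denSeq (k := k) (by omega) (m + 1 - 2 * k)
    rw [denSeq_of_le (by omega) h]
    calc 2 * denSeq k m ^ 2 ≤ denSeq k m * denSeq k m ^ 2 := Nat.mul_le_mul_right _ h0
      _ = denSeq k m ^ 3 := by ring
      _ ≤ denSeq k m ^ (3 * (denSeq k (m + 1 - k)).totient) :=
        Nat.pow_le_pow_right (by omega) (by omega)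
      _ ≤ _ := Nat.pow_le_pow_left hP _
      _ ≤ _ := Nat.le_mul_of_pos_left _ (by omega)
      _ ≤ _ := Nat.le_add_left _ _

/-- Along any two-element set of residues modulo `k`, the values of `Q` satisfy a continued
fraction recursion. -/
structure IsDenominatorSeq (k : ℕ) (Q : ℕ → ℕ) : Prop where
  two_le : ∀ i, 2 ≤ Q i
  growth : ∀ i, 2 * Q i ^ 2 ≤ Q (i + 1)
  coprime : ∀ i d, 0 < d → d ≤ k → Nat.Coprime (Q i) (Q (i + d))
  modEq_of_lt : ∀ i d, 0 < d → d < k → Q i ≡ Q (i + k) [MOD Q (i + d)]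
  modEq : ∀ i, Q i ≡ Q (i + 2 * k) [MOD Q (i + k)]

theorem exists_isDenominatorSeq {k : ℕ} (hk : 2 ≤ k) : ∃ Q, IsDenominatorSeq k Q := by
  refine ⟨fun i => denSeq k (i + k), ⟨fun i => two_le_denSeq (by omega) _, fun i => ?_,
    fun i d hd hdk => ?_, fun i d hd hdk => ?_, fun i => ?_⟩⟩
  · simp only [show i + 1 + k = i + k + 1 by omega]
    exact two_mul_sq_denSeq_le hk _
  · have := coprime_denSeq (k := k) (i + d + k) d hd hdk (by omega)
    rw [show i + d + k - d = i + k by omega] at this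
    exact this.symm
  · have := denSeq_modEq_of_lt (k := k) (m := i + k + k) (d := k - d) (by omega) (by omega)
      (by omega)
    rw [show i + k + k - (k - d) = i + d + k by omega, Nat.add_sub_cancel] at this
    exact this.symm
  · have := denSeq_modEq_of_coprime (k := k) (m := i + 2 * k + k) (by omega) (by omega)
      fun d hd hdk => by
        have := coprime_denSeq (k := k) (i + 2 * k + k - d) (k - d) (by omega) (by omega)
          (by omega)
        rwa [show i + 2 * k + k - d - (k - d) = i + 2 * k + k - k by omega] at this
    rw [show i + 2 * k + k - 2 * k = i + k by omega,
      show i + 2 * k + k - k = i + k + k by omega] at this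
    exact this.symm

theorem exists_convergents (q a : ℕ → ℤ) (h01 : IsCoprime (q 0) (q 1))
    (hrec : ∀ n, q (n + 2) = a n * q (n + 1) + q n) :
    ∃ p : ℕ → ℤ, (∀ n, p (n + 2) = a n * p (n + 1) + p n) ∧
      ∀ n, p (n + 1) * q n - p n * q (n + 1) = (-1) ^ n := by
  obtain ⟨u, v, huv⟩ := h01
  let s : ℕ → ℤ × ℤ := fun n => Nat.rec (-v, u) (fun n x => (x.2, a n * x.2 + x.1)) n
  refine ⟨fun n => (s n).1, fun n => rfl, fun n => ?_⟩
  induction n with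
  | zero => change u * q 0 - (-v) * q 1 = _; linear_combination huv
  | succ n ih =>
    change (a n * (s (n + 1)).1 + (s n).1) * q (n + 1) - (s (n + 1)).1 * q (n + 2) = _
    rw [hrec n, pow_succ, ← ih]
    ring

/-- A strictly increasing sequence satisfying a continued fraction recursion is the sequence of
denominators of best approximations of some irrational number `α`, and `D n` is the value of
`psi α` between the denominators `q n` and `q (n + 1)`. -/
theorem exists_irrational_psi_eq (q : ℕ → ℕ) (h0 : 0 < q 0) (hmono : StrictMono q)
    (h01 : Nat.Coprime (q 0) (q 1)) (hmod : ∀ n, q n ≡ q (n + 2) [MOD q (n + 1)]) :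
    ∃ (α : ℝ) (D : ℕ → ℝ), Irrational α ∧ (∀ n, 0 < D n) ∧
      (∀ n, q (n + 1) * D n + q n * D (n + 1) = 1) ∧
      ∀ n (t : ℝ), q n ≤ t → t < q (n + 1) → psi α t = D n := by
  have hqpos : ∀ n, 0 < q n := fun n => h0.trans_le (hmono.monotone (Nat.zero_le n))
  have hqR : ∀ n, (0 : ℝ) < q n := fun n => by exact_mod_cast hqpos n
  have hrec : ∀ n, ∃ a : ℤ, 0 < a ∧ (q (n + 2) : ℤ) = a * q (n + 1) + q n := by
    intro n
    obtain ⟨a, ha⟩ := (Nat.modEq_iff_dvd.1 (hmod n))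
    have hlt : (q n : ℤ) < q (n + 2) := by exact_mod_cast hmono (by omega)
    have hp : (0 : ℤ) < q (n + 1) := by exact_mod_cast hqpos (n + 1)
    exact ⟨a, pos_of_mul_pos_right (by linarith) hp.le, by linear_combination ha⟩
  choose a ha hrec using hrec
  obtain ⟨p, hp, hdet⟩ := exists_convergents (fun n => (q n : ℤ)) a
    (Nat.isCoprime_iff_coprime.2 h01) hrec
  have hdetR : ∀ n, (p (n + 1) * q n - p n * q (n + 1) : ℝ) = (-1) ^ n := fun n => by
    exact_mod_cast hdet n
  have hrecR : ∀ n, (q (n + 2) : ℝ) = a n * q (n + 1) + q n := fun n => by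
    exact_mod_cast hrec n
  have hpR : ∀ n, (p (n + 2) : ℝ) = a n * p (n + 1) + p n := fun n => by
    exact_mod_cast hp n
  have haR : ∀ n, (0 : ℝ) < a n := fun n => by exact_mod_cast ha n
  have hstep : ∀ n, (p (n + 2) * q n - p n * q (n + 2) : ℝ) = a n * (-1) ^ n := fun n => by
    rw [hrecR, hpR, ← hdetR]; ring
  obtain ⟨α, hα⟩ : ∃ α : ℝ, ∀ n, (p (2 * n) : ℝ) / q (2 * n) ≤ α ∧
      α ≤ (p (2 * n + 1) : ℝ) / q (2 * n + 1) := by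
    have h := Monotone.ciSup_mem_iInter_Icc_of_antitone
      (f := fun n => (p (2 * n) : ℝ) / q (2 * n))
      (g := fun n => (p (2 * n + 1) : ℝ) / q (2 * n + 1)) ?_ ?_ ?_
    · exact ⟨_, fun n => Set.mem_iInter.1 h n⟩
    · refine monotone_nat_of_le_succ fun n => ?_
      rw [div_le_div_iff₀ (hqR _) (hqR _)]
      have := hstep (2 * n)
      rw [pow_mul, neg_one_sq, one_pow] at this
      have := haR (2 * n)
      change (p (2 * n) * q (2 * n + 2) : ℝ) ≤ p (2 * n + 2) * q (2 * n)
      linarith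
    · refine antitone_nat_of_succ_le fun n => ?_
      rw [div_le_div_iff₀ (hqR _) (hqR _)]
      have := hstep (2 * n + 1)
      rw [pow_succ, pow_mul, neg_one_sq, one_pow] at this
      have := haR (2 * n + 1)
      change (p (2 * n + 1 + 2) * q (2 * n + 1) : ℝ) ≤ p (2 * n + 1) * q (2 * n + 1 + 2)
      linarith
    · intro n
      simp only
      rw [div_le_div_iff₀ (hqR _) (hqR _)]
      have := hdetR (2 * n)
      rw [pow_mul, neg_one_sq, one_pow] at this
      linarith
  let E : ℕ → ℝ := fun n => (-1) ^ n * (q n * α - p n)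
  have hsq : ∀ n : ℕ, ((-1 : ℝ) ^ n) * (-1) ^ n = 1 := fun n => by
    rw [← mul_pow]; simp
  have hE0 : ∀ n, 0 ≤ E n := by
    intro n
    obtain ⟨m, rfl | rfl⟩ := n.even_or_odd'
    · have := (div_le_iff₀ (hqR _)).1 (hα m).1
      simp only [E, pow_mul, neg_one_sq, one_pow]
      linarith
    · have := (le_div_iff₀ (hqR _)).1 (hα m).2
      simp only [E, pow_add, pow_mul, neg_one_sq, one_pow, pow_one]
      linarith
  have hE1 : ∀ n, q (n + 1) * E n + q n * E (n + 1) = 1 := fun n => by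
    simp only [E, pow_succ]
    linear_combination (-1) ^ n * hdetR n + hsq n
  have hE2 : ∀ n, E n = a n * E (n + 1) + E (n + 2) := fun n => by
    simp only [E, pow_succ, hrecR, hpR]
    ring
  have hE : ∀ n, 0 < E n := by
    intro n
    refine (hE0 n).lt_of_ne' fun h => ?_
    have h1 := mul_nonneg (haR n).le (hE0 (n + 1))
    have h2 := hE2 n
    have h3 := hE0 (n + 2)
    have h4 : E (n + 1) = 0 := by
      rcases mul_eq_zero.1 (show (a n : ℝ) * E (n + 1) = 0 by linarith) with h | h
      · exact absurd h (haR n).ne'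
      · exact h
    have := hE1 n
    simp [h, h4] at this
  have hbest : ∀ n (x y : ℤ), 1 ≤ x → x < q (n + 1) → E n ≤ |x * α - y| := by
    intro n x y hx hxq
    let u : ℤ := (-1) ^ n * (x * p (n + 1) - y * q (n + 1))
    let v : ℤ := (-1) ^ n * (q n * y - p n * x)
    have hsqZ : ((-1 : ℤ) ^ n) * (-1) ^ n = 1 := by exact_mod_cast hsq n
    have hxu : x = u * q n + v * q (n + 1) := by
      simp only [u, v]
      linear_combination -(-1) ^ n * x * hdet n - x * hsqZ
    have hyu : y = u * p n + v * p (n + 1) := by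
      simp only [u, v]
      linear_combination -(-1) ^ n * y * hdet n - y * hsqZ
    have hval : |x * α - y| = |u * E n - v * E (n + 1)| := by
      have : (x * α - y : ℝ) = (-1) ^ n * (u * E n - v * E (n + 1)) := by
        rw [hxu, hyu]
        simp only [E, pow_succ]
        push_cast
        linear_combination (-u * (q n * α - p n) - v * (q (n + 1) * α - p (n + 1))) * hsq n
      rw [this, abs_mul, abs_pow]
      simp
    have hq0 : (0 : ℤ) < q n := by exact_mod_cast hqpos n
    have hq1 : (0 : ℤ) < q (n + 1) := by exact_mod_cast hqpos (n + 1)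
    have key : (1 ≤ u ∧ v ≤ 0) ∨ (u ≤ -1 ∧ 0 ≤ v) := by
      rcases lt_or_ge 0 v with hv | hv
      · refine Or.inr ⟨?_, hv.le⟩
        by_contra! hu
        nlinarith [mul_nonneg (show 0 ≤ u by omega) hq0.le]
      · refine Or.inl ⟨?_, hv⟩
        by_contra! hu
        nlinarith [mul_nonneg (show 0 ≤ -u by omega) hq0.le]
    have hn := hE n
    have hn1 := hE (n + 1)
    rw [hval]
    rcases key with ⟨hu, hv⟩ | ⟨hu, hv⟩
    · have hu' : (1 : ℝ) ≤ u := by exact_mod_cast hu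
      have hv' : (v : ℝ) ≤ 0 := by exact_mod_cast hv
      refine le_trans ?_ (le_abs_self _)
      nlinarith
    · have hu' : (u : ℝ) ≤ -1 := by exact_mod_cast hu
      have hv' : (0 : ℝ) ≤ v := by exact_mod_cast hv
      refine le_trans ?_ (neg_le_abs _)
      nlinarith
  refine ⟨α, E, ?_, hE, hE1, fun n t ht ht' => ?_⟩
  · rintro ⟨r, hr⟩
    have hden : (0 : ℝ) < r.den := by exact_mod_cast r.den_pos
    have hlt : (r.den : ℝ) < q (r.den + 1) := by
      exact_mod_cast Nat.lt_of_lt_of_le (Nat.lt_succ_self _) (hmono.id_le (r.den + 1))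
    have hpos := hE r.den
    have hint : E r.den * r.den =
        (((-1) ^ r.den * (q r.den * r.num - p r.den * r.den) : ℤ) : ℝ) := by
      have hnum : (r : ℝ) * r.den = r.num := by exact_mod_cast Rat.mul_den_eq_num r
      simp only [E, ← hr]
      push_cast
      linear_combination (-1) ^ r.den * (q r.den : ℝ) * hnum
    have hge : 1 ≤ E r.den * r.den := by
      have h1 : 0 < E r.den * r.den := by positivity
      rw [hint] at h1 ⊢
      exact_mod_cast Int.cast_pos.1 h1
    have h2 := hE1 r.den
    have h3 := mul_pos (hqR r.den) (hE (r.den + 1))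
    nlinarith
  · unfold psi
    refine IsLeast.csInf_eq ⟨⟨q n, ⟨?_, ?_⟩, ?_⟩, ?_⟩
    · exact_mod_cast hqpos n
    · exact_mod_cast ht
    · have hEn : E n = |q n * α - p n| := by
        rw [← abs_of_pos (hE n)]
        simp [E, abs_mul]
      refine le_antisymm ?_ ?_
      · rw [hEn]
        simpa [distToInt] using round_le (q n * α) (p n)
      · exact hbest n _ _ (by exact_mod_cast hqpos n) (by exact_mod_cast hmono (Nat.lt_succ_self n))
    · rintro _ ⟨x, ⟨hx, hxt⟩, rfl⟩
      exact hbest n x _ hx (by exact_mod_cast hxt.trans_lt ht')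

section NextHit

variable {k : ℕ}

theorem natCast_zmod_ne_of_lt {a b : ℕ} (hab : a < b) (hb : b < a + k) : (a : ZMod k) ≠ b := by
  intro h
  have := Nat.le_of_dvd (by omega)
    ((Nat.modEq_iff_dvd' hab.le).1 ((ZMod.natCast_eq_natCast_iff _ _ _).1 h))
  omega

theorem eq_or_eq_or_eq_of_mem_sym2 {X : Type*} {z : Sym2 X} {x y w : X} (hx : x ∈ z) (hy : y ∈ z)
    (hw : w ∈ z) : x = y ∨ x = w ∨ y = w := by
  induction z using Sym2.ind with
  | _ i j =>
    rw [Sym2.mem_iff] at hx hy hw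
    rcases hx with rfl | rfl <;> rcases hy with rfl | rfl <;> rcases hw with rfl | rfl <;> simp

/-- The first natural number after `s` whose residue modulo `k` belongs to `z`. -/
noncomputable def nextHit (z : Sym2 (ZMod k)) (s : ℕ) : ℕ :=
  sInf {m : ℕ | s < m ∧ (m : ZMod k) ∈ z}

theorem nextHit_le_of_mem {z : Sym2 (ZMod k)} {s m : ℕ} (hm : s < m) (hz : (m : ZMod k) ∈ z) :
    nextHit z s ≤ m :=
  Nat.sInf_le ⟨hm, hz⟩

/-- The order at stage `s`: the next two hits decide which of two functions is smaller. -/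
def HitOrder (s : ℕ) (z w : Sym2 (ZMod k)) : Prop :=
  nextHit w s < nextHit z s ∨
    (nextHit w s = nextHit z s ∧ nextHit z (nextHit z s) < nextHit w (nextHit w s))

theorem HitOrder.asymm {s : ℕ} {z w : Sym2 (ZMod k)} (h : HitOrder s z w) : ¬ HitOrder s w z := by
  unfold HitOrder at *
  omega

variable [NeZero k]

theorem exists_natCast_zmod_eq (x : ZMod k) (s : ℕ) :
    ∃ m : ℕ, s < m ∧ m ≤ s + k ∧ (m : ZMod k) = x := by
  refine ⟨s + 1 + (x - ((s + 1 : ℕ) : ZMod k)).val, by omega, ?_, by simp⟩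
  have := ZMod.val_lt (x - ((s + 1 : ℕ) : ZMod k))
  omega

theorem nextHit_spec (z : Sym2 (ZMod k)) (s : ℕ) :
    s < nextHit z s ∧ (nextHit z s : ZMod k) ∈ z := by
  refine Nat.sInf_mem (s := {m : ℕ | s < m ∧ (m : ZMod k) ∈ z}) ?_
  induction z using Sym2.ind with
  | _ i j =>
    obtain ⟨m, hm, -, hi⟩ := exists_natCast_zmod_eq i s
    exact ⟨m, hm, by simp [hi]⟩

theorem lt_nextHit (z : Sym2 (ZMod k)) (s : ℕ) : s < nextHit z s := (nextHit_spec z s).1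

theorem nextHit_mem (z : Sym2 (ZMod k)) (s : ℕ) : (nextHit z s : ZMod k) ∈ z :=
  (nextHit_spec z s).2

theorem nextHit_le_add (z : Sym2 (ZMod k)) (s : ℕ) : nextHit z s ≤ s + k := by
  induction z using Sym2.ind with
  | _ i j =>
    obtain ⟨m, hm, hmk, hi⟩ := exists_natCast_zmod_eq i s
    exact (nextHit_le_of_mem hm (by simp [hi])).trans hmk

theorem nextHit_add_period (z : Sym2 (ZMod k)) (s : ℕ) : nextHit z (s + k) = nextHit z s + k := by
  apply le_antisymm
  · exact nextHit_le_of_mem (by have := lt_nextHit z s; omega) (by simpa using nextHit_mem z s)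
  · have h := lt_nextHit z (s + k)
    have h' := nextHit_mem z (s + k)
    obtain ⟨m, hm⟩ := Nat.exists_eq_add_of_le' (show k ≤ nextHit z (s + k) by omega)
    rw [hm] at h h' ⊢
    exact Nat.add_le_add_right (nextHit_le_of_mem (by omega) (by simpa using h')) k

theorem nextHit_eq_of_le_of_lt {z : Sym2 (ZMod k)} {p s : ℕ} (hps : p ≤ s)
    (hs : s < nextHit z p) : nextHit z s = nextHit z p :=
  le_antisymm (nextHit_le_of_mem hs (nextHit_mem z p))
    (nextHit_le_of_mem (hps.trans_lt (lt_nextHit z s)) (nextHit_mem z s))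

theorem nextHit_nextHit_cases {z : Sym2 (ZMod k)} {a : ℕ} (ha : (a : ZMod k) ∈ z) :
    (nextHit z a = a + k ∧ nextHit z (nextHit z a) = a + 2 * k) ∨
      (nextHit z a < a + k ∧ nextHit z (nextHit z a) = a + k) := by
  have hab := lt_nextHit z a
  have hbc := lt_nextHit z (nextHit z a)
  have hb := nextHit_mem z a
  have hc := nextHit_mem z (nextHit z a)
  rcases (nextHit_le_add z a).eq_or_lt with h | h
  · left
    refine ⟨h, ?_⟩
    rw [h, nextHit_add_period, h]
    ring
  · right
    refine ⟨h, ?_⟩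
    have hle : nextHit z (nextHit z a) ≤ a + k := nextHit_le_of_mem h (by simpa using ha)
    by_contra hne
    rcases eq_or_eq_or_eq_of_mem_sym2 ha hb hc with h | h | h
    · exact natCast_zmod_ne_of_lt hab (by omega) h
    · exact natCast_zmod_ne_of_lt (hab.trans hbc) (by omega) h
    · exact natCast_zmod_ne_of_lt hbc (by omega) h

theorem mem_iff_eq_nextHit (z : Sym2 (ZMod k)) (s : ℕ) (x : ZMod k) :
    x ∈ z ↔ x = nextHit z s ∨ x = nextHit z (nextHit z s) := by
  have hb := nextHit_mem z s
  have hc := nextHit_mem z (nextHit z s)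
  refine ⟨fun hx => ?_, by rintro (rfl | rfl) <;> assumption⟩
  by_contra! hne
  rcases eq_or_eq_or_eq_of_mem_sym2 hx hb hc with h | h | h
  · exact hne.1 h
  · exact hne.2 h
  · obtain ⟨m, hm, hmk, rfl⟩ := exists_natCast_zmod_eq x (nextHit z s)
    have h1 := nextHit_le_of_mem hm hx
    have h2 : nextHit z (nextHit z s) ≠ m := fun h => hne.2 (by rw [h])
    exact natCast_zmod_ne_of_lt (lt_nextHit z (nextHit z s)) (by omega) h

theorem eq_of_nextHit_eq {z w : Sym2 (ZMod k)} {s : ℕ} (h : nextHit z s = nextHit w s)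
    (h' : nextHit z (nextHit z s) = nextHit w (nextHit w s)) : z = w := by
  ext x
  rw [mem_iff_eq_nextHit z s, mem_iff_eq_nextHit w s, h', h]

theorem HitOrder.trichotomy (s : ℕ) {z w : Sym2 (ZMod k)} (h : z ≠ w) :
    HitOrder s z w ∨ HitOrder s w z := by
  have : ¬ (nextHit z s = nextHit w s ∧ nextHit z (nextHit z s) = nextHit w (nextHit w s)) :=
    fun H => h (eq_of_nextHit_eq H.1 H.2)
  unfold HitOrder
  omega

theorem hitOrder_add_mul (s j : ℕ) (z w : Sym2 (ZMod k)) :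
    HitOrder (s + k * j) z w ↔ HitOrder s z w := by
  induction j with
  | zero => rfl
  | succ j ih =>
    rw [← ih, mul_add, mul_one, ← add_assoc]
    simp only [HitOrder, nextHit_add_period, add_lt_add_iff_right, add_left_inj]

theorem hitOrder_diag (s : ℕ) {z : Sym2 (ZMod k)} (hz : z ≠ Sym2.diag ((s : ZMod k) + 1)) :
    HitOrder s z (Sym2.diag ((s : ZMod k) + 1)) := by
  have hk := NeZero.pos k
  have h1 : nextHit (Sym2.diag ((s : ZMod k) + 1)) s = s + 1 :=
    le_antisymm (nextHit_le_of_mem (by omega) (by simp [Sym2.diag])) (lt_nextHit _ _)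
  have h2 := nextHit_nextHit_cases (z := Sym2.diag ((s : ZMod k) + 1)) (a := s + 1)
    (by simp [Sym2.diag])
  have h3 : nextHit (Sym2.diag ((s : ZMod k) + 1)) (s + 1) = s + 1 + k := by
    refine le_antisymm (nextHit_le_add _ _) (not_lt.1 fun hlt => ?_)
    have := nextHit_mem (Sym2.diag ((s : ZMod k) + 1)) (s + 1)
    refine natCast_zmod_ne_of_lt (lt_nextHit (Sym2.diag ((s : ZMod k) + 1)) (s + 1)) hlt ?_
    simpa [Sym2.diag, eq_comm] using this
  have h4 := lt_nextHit z s
  have h5 := nextHit_le_add z (nextHit z s)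
  refine (HitOrder.trichotomy s hz).resolve_right fun h => ?_
  unfold HitOrder at h
  rw [h1, h3] at h
  omega

end NextHit

section OrderVectors

variable {n : ℕ}

theorem exists_isOrderVec {α : Fin n → ℝ} {t : ℝ} (h : Function.Injective fun i => psi (α i) t) :
    ∃ v, IsOrderVec α t v := by
  refine ⟨Tuple.sort fun i => -psi (α i) t, Equiv.bijective _, fun p q hpq => ?_⟩
  have hle := Tuple.monotone_sort (fun i => -psi (α i) t) hpq.le
  refine lt_of_le_of_ne (neg_le_neg_iff.1 hle) fun heq => hpq.ne ?_
  exact ((Tuple.sort fun i => -psi (α i) t).injective (h heq)).symm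

theorem IsOrderVec.unique {α : Fin n → ℝ} {t : ℝ} {v w : Fin n → Fin n}
    (hv : IsOrderVec α t v) (hw : IsOrderVec α t w)
    (h : Function.Injective fun i => psi (α i) t) : v = w := by
  have key : (fun p => -psi (α (v p)) t) = fun p => -psi (α (w p)) t := by
    refine (StrictMono.range_inj (fun p q hpq => neg_lt_neg (hv.2 p q hpq))
      (fun p q hpq => neg_lt_neg (hw.2 p q hpq))).1 ?_
    exact (hv.1.surjective.range_comp (fun i => -psi (α i) t)).trans
      (hw.1.surjective.range_comp (fun i => -psi (α i) t)).symm
  funext p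
  exact h (neg_injective (congrFun key p))

theorem IsOrderVec.sameOrder {α : Fin n → ℝ} {t t' : ℝ} {v : Fin n → Fin n}
    (hv : IsOrderVec α t v) (hv' : IsOrderVec α t' v) : SameOrder α t t' := by
  intro i j
  obtain ⟨p, rfl⟩ := hv.1.surjective i
  obtain ⟨q, rfl⟩ := hv.1.surjective j
  have anti : StrictAnti fun p => psi (α (v p)) t := fun p q h => hv.2 p q h
  have anti' : StrictAnti fun p => psi (α (v p)) t' := fun p q h => hv'.2 p q h
  exact anti.lt_iff_gt.trans anti'.lt_iff_gt.symm

theorem IsOrderVec.of_sameOrder {α : Fin n → ℝ} {t t' : ℝ} {v : Fin n → Fin n}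
    (hv : IsOrderVec α t v) (h : SameOrder α t t') : IsOrderVec α t' v :=
  ⟨hv.1, fun p q hpq => (h _ _).1 (hv.2 p q hpq)⟩

/-- If for large `t` the order of the values `psi (α i) t` is governed by a stage in `S`, every
stage occurs at arbitrarily large times, and distinct stages give distinct orders, then the
number of order vectors is the number of stages. -/
theorem kAlpha_eq_card {S : Type*} (α : Fin n → ℝ) (R : S → Fin n → Fin n → Prop) (T₀ : ℝ)
    (hinj : ∀ t, T₀ ≤ t → Function.Injective fun i => psi (α i) t)
    (hstage : ∀ t, T₀ ≤ t → ∃ s, ∀ i j, psi (α i) t < psi (α j) t ↔ R s i j)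
    (hrecur : ∀ s T, ∃ t, T < t ∧ ∀ i j, psi (α i) t < psi (α j) t ↔ R s i j)
    (hR : Function.Injective R) : kAlpha α = Nat.card S := by
  have hex : ∀ s, ∃ t, T₀ ≤ t ∧ (∀ i j, psi (α i) t < psi (α j) t ↔ R s i j) ∧
      ∃ v, IsOrderVec α t v := fun s => by
    obtain ⟨t, ht, hRt⟩ := hrecur s T₀
    exact ⟨t, ht.le, hRt, exists_isOrderVec (hinj t ht.le)⟩
  choose τ hτ hRτ v hv using hex
  have hocc : ∀ s, OccursInfinitely α (v s) := fun s T => by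
    obtain ⟨t, ht, hRt⟩ := hrecur s T
    exact ⟨t, ht, (hv s).of_sameOrder fun i j => (hRτ s i j).trans (hRt i j).symm⟩
  refine (Nat.card_congr (Equiv.ofBijective
    (fun s => (⟨v s, hocc s⟩ : {v : Fin n → Fin n | OccursInfinitely α v})) ⟨?_, ?_⟩)).symm
  · intro s s' h
    have hvv : v s = v s' := congrArg Subtype.val h
    have hso : SameOrder α (τ s) (τ s') := (hv s).sameOrder (hvv ▸ hv s')
    refine hR ?_
    funext i j
    exact propext ((hRτ s i j).symm.trans ((hso i j).trans (hRτ s' i j)))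
  · rintro ⟨w, hw⟩
    obtain ⟨t, ht, hwt⟩ := hw T₀
    obtain ⟨s, hs⟩ := hstage t ht.le
    refine ⟨s, Subtype.ext ?_⟩
    exact ((hv s).of_sameOrder fun i j => (hRτ s i j).trans (hs i j).symm).unique hwt
      (hinj t ht.le)

end OrderVectors

namespace IsDenominatorSeq

variable {k : ℕ} {Q : ℕ → ℕ}

theorem two_mul_le (hQ : IsDenominatorSeq k Q) {i j : ℕ} (h : i < j) : 2 * Q i ≤ Q j := by
  induction j, h using Nat.le_induction with
  | base => nlinarith [hQ.growth i, hQ.two_le i]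
  | succ j _ ih => nlinarith [hQ.growth j, hQ.two_le j]

theorem strictMono (hQ : IsDenominatorSeq k Q) : StrictMono Q := fun i j h => by
  have := hQ.two_mul_le h
  have := hQ.two_le i
  omega

/-- The convergents with denominators `Q m`, for `m` with residue in `z`, define an irrational
number. If `b` and `c` are the next two hits after `s`, then its irrationality measure function
at stage `s` is about `1 / Q b - Q a / (Q b * Q c)`. -/
theorem exists_irrational_psi [NeZero k] (hQ : IsDenominatorSeq k Q) (z : Sym2 (ZMod k)) :
    ∃ α : ℝ, Irrational α ∧ ∀ s, k ≤ s → ∃ a ≤ s, ∃ D D' : ℝ,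
      (∀ t : ℝ, Q s ≤ t → t < Q (s + 1) → psi α t = D) ∧
      Q (nextHit z s) * D + Q a * D' = 1 ∧
      Q (nextHit z (nextHit z s)) * D' < 1 ∧
      1 < 2 * (Q (nextHit z (nextHit z s)) * D') := by
  let e : ℕ → ℕ := fun n => (nextHit z)^[n + 1] 0
  have he : ∀ n, e (n + 1) = nextHit z (e n) := fun n => Function.iterate_succ_apply' _ _ _
  have hmem : ∀ n, (e n : ZMod k) ∈ z := fun n => by
    simp only [e, Function.iterate_succ_apply']
    exact nextHit_mem _ _
  have hlt : ∀ n, e n < e (n + 1) := fun n => he n ▸ lt_nextHit z (e n)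
  have hmono : StrictMono e := strictMono_nat_of_lt_succ hlt
  have hcop : ∀ n, Nat.Coprime (Q (e n)) (Q (e (n + 1))) := fun n => by
    have h1 := hlt n
    have h2 : e (n + 1) ≤ e n + k := he n ▸ nextHit_le_add z (e n)
    have := hQ.coprime (e n) (e (n + 1) - e n) (by omega) (by omega)
    rwa [show e n + (e (n + 1) - e n) = e (n + 1) by omega] at this
  have hmod : ∀ n, Q (e n) ≡ Q (e (n + 2)) [MOD Q (e (n + 1))] := fun n => by
    have h1 := hlt n
    have h := nextHit_nextHit_cases (hmem n)
    rw [← he, ← he] at h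
    rcases h with ⟨hb, hc⟩ | ⟨hb, hc⟩
    · rw [hb, hc]
      exact hQ.modEq _
    · have := hQ.modEq_of_lt (e n) (e (n + 1) - e n) (by omega) (by omega)
      rwa [show e n + (e (n + 1) - e n) = e (n + 1) by omega, ← hc] at this
  obtain ⟨α, D, hα, hD, hrel, hpsi⟩ := exists_irrational_psi_eq (fun n => Q (e n))
    (by have := hQ.two_le (e 0); omega) (hQ.strictMono.comp hmono) (hcop 0) hmod
  refine ⟨α, hα, fun s hs => ?_⟩
  obtain ⟨n, hn, hn'⟩ : ∃ n, e n ≤ s ∧ s < e (n + 1) := by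
    have h0 : e 0 ≤ s := by
      have := nextHit_le_add z 0
      simp only [e, zero_add, Function.iterate_one]
      omega
    have hex : ∃ m, s < e m := ⟨s + 1, hmono.id_le (s + 1)⟩
    refine ⟨Nat.find hex - 1, not_lt.1 (Nat.find_min hex ?_), ?_⟩
    · have : Nat.find hex ≠ 0 := fun h => by
        have := Nat.find_spec hex
        rw [h] at this
        omega
      omega
    · exact (Nat.find_spec hex).trans_le (hmono.monotone (by omega))
  have hb : nextHit z s = e (n + 1) := by
    rw [he] at hn' ⊢
    exact nextHit_eq_of_le_of_lt hn hn'
  rw [hb, ← he]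
  refine ⟨e n, hn, D n, D (n + 1), fun t ht ht' => hpsi n t ?_ ?_, hrel n, ?_, ?_⟩
  · exact le_trans (by exact_mod_cast hQ.strictMono.monotone hn) ht
  · exact ht'.trans_le (by exact_mod_cast hQ.strictMono.monotone hn')
  all_goals
    have h1 := hrel (n + 1)
    have h2 := hrel (n + 2)
    have h3 := hD (n + 2)
    have h4 := hD (n + 3)
    have h5 : (0 : ℝ) < Q (e (n + 1)) := by
      exact_mod_cast (hQ.two_le (e (n + 1))).trans_lt' two_pos
    have h6 : (0 : ℝ) < Q (e (n + 2)) := by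
      exact_mod_cast (hQ.two_le (e (n + 2))).trans_lt' two_pos
    have h7 : (2 * Q (e (n + 1)) : ℝ) ≤ Q (e (n + 3)) := by
      exact_mod_cast hQ.two_mul_le (hmono (show n + 1 < n + 3 by omega))
    have h8 := mul_pos h5 h3
    have h9 := mul_pos h6 h4
    change (Q (e (n + 2)) * D (n + 1) + Q (e (n + 1)) * D (n + 2) : ℝ) = 1 at h1
    change (Q (e (n + 3)) * D (n + 2) + Q (e (n + 2)) * D (n + 3) : ℝ) = 1 at h2
    nlinarith

/-- If `a ≤ s < b < c` and `a' ≤ s < b' < c'` are consecutive hits of two pairs around stage `s`,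
the value `D` is smaller than `d` whenever `b' < b`, or `b = b'` and `c < c'`. -/
theorem value_lt (hQ : IsDenominatorSeq k Q) {s a b c a' b' c' : ℕ} {D D' d d' : ℝ}
    (hsb : s < b) (hbc : b < c) (ha' : a' ≤ s) (hsb' : s < b') (hbc' : b' < c')
    (hD : Q b * D + Q a * D' = 1) (hD' : 1 < 2 * (Q c * D'))
    (hd : Q b' * d + Q a' * d' = 1) (hd' : Q c' * d' < 1) (hd0 : 1 < 2 * (Q c' * d'))
    (h : b' < b ∨ (b' = b ∧ c < c')) : D < d := by
  have pos : ∀ i, (2 : ℝ) ≤ Q i := fun i => by exact_mod_cast hQ.two_le i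
  have dbl : ∀ {i j : ℕ}, i < j → (2 * Q i : ℝ) ≤ Q j := fun h => by
    exact_mod_cast hQ.two_mul_le h
  have hD'pos : 0 < D' := by
    by_contra! h
    nlinarith [pos c]
  have hd'pos : 0 < d' := by
    by_contra! h
    nlinarith [pos c']
  rcases h with h | ⟨rfl, h⟩
  · have h1 : (Q a' : ℝ) * d' < 1 / 2 := by
      nlinarith [dbl (show a' < c' by omega), pos a']
    have h2 : (Q b : ℝ) * D < 1 := by nlinarith [pos a]
    have h3 : 1 / 2 < (Q b' : ℝ) * d := by linarith
    have hd : 0 < d := by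
      by_contra! h
      nlinarith [pos b']
    have h4 : (Q b : ℝ) * D < Q b * d := by nlinarith [dbl h]
    exact lt_of_mul_lt_mul_left h4 (by linarith [pos b])
  · have hg : (2 * Q c ^ 2 : ℝ) ≤ Q c' := by
      have := (hQ.growth c).trans (hQ.strictMono.monotone (show c + 1 ≤ c' by omega))
      exact_mod_cast this
    have hac : (2 * Q a' : ℝ) ≤ Q c := dbl (by omega)
    have key : (Q a' : ℝ) * d' < Q a * D' := by
      have h1 : (Q c : ℝ) * (Q a' * d') < Q c * (Q a * D') := by
        have h2 : (Q c * (Q a' * d') : ℝ) ≤ Q c' * d' / 2 := by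
          have : (Q c * Q a' : ℝ) ≤ Q c' / 2 := by nlinarith [pos c, pos a']
          nlinarith
        have h3 : (Q c * D' : ℝ) ≤ Q c * (Q a * D') := by
          have : (Q c * D' : ℝ) * 1 ≤ (Q c * D') * Q a :=
            mul_le_mul_of_nonneg_left (by linarith [pos a]) (by nlinarith [pos c])
          linarith
        linarith
      exact lt_of_mul_lt_mul_left h1 (by linarith [pos c])
    have h4 : (Q b' : ℝ) * D < Q b' * d := by linarith
    exact lt_of_mul_lt_mul_left h4 (by linarith [pos b'])

theorem exists_family [NeZero k] (hQ : IsDenominatorSeq k Q) :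
    ∃ β : Sym2 (ZMod k) → ℝ, (∀ z, Irrational (β z)) ∧ ∀ s, k ≤ s → ∀ t : ℝ, Q s ≤ t →
      t < Q (s + 1) → ∀ z w, HitOrder s z w → psi (β z) t < psi (β w) t := by
  choose β hβ h using hQ.exists_irrational_psi
  refine ⟨β, hβ, fun s hs t ht ht' z w hzw => ?_⟩
  obtain ⟨a, -, D, D', hpsi, hD, -, hD'⟩ := h z s hs
  obtain ⟨a', ha', d, d', hpsi', hd, hd1, hd'⟩ := h w s hs
  rw [hpsi t ht ht', hpsi' t ht ht']
  exact hQ.value_lt (lt_nextHit z s) (lt_nextHit z _) ha' (lt_nextHit w s) (lt_nextHit w _)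
    hD hD' hd hd1 hd' hzw

theorem exists_stage (hQ : IsDenominatorSeq k Q) {N : ℕ} {t : ℝ} (ht : Q N ≤ t) :
    ∃ s, N ≤ s ∧ Q s ≤ t ∧ t < Q (s + 1) := by
  have hex : ∃ m, t < Q (m + 1) := by
    obtain ⟨m, hm⟩ := exists_nat_gt t
    exact ⟨m, hm.trans (by exact_mod_cast hQ.strictMono.id_le (m + 1))⟩
  have hN : N ≤ Nat.find hex := by
    by_contra! h
    have h1 : (Q (Nat.find hex + 1) : ℝ) ≤ Q N := by
      exact_mod_cast hQ.strictMono.monotone (show Nat.find hex + 1 ≤ N by omega)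
    exact absurd (Nat.find_spec hex) (not_lt.2 (h1.trans ht))
  refine ⟨Nat.find hex, hN, ?_, Nat.find_spec hex⟩
  rcases hN.eq_or_lt with h | h
  · rwa [← h]
  · have := not_lt.1 (Nat.find_min hex (m := Nat.find hex - 1) (by omega))
    rwa [Nat.sub_add_cancel (by omega)] at this

end IsDenominatorSeq

/-- **Manturov–Moshchevitin.** For `k ≥ 3` and `n = k(k+1)/2` there is an `n`-tuple of
pairwise independent irrational numbers with `k(α) = k`. -/
theorem stmt1 (k : ℕ) (hk : 3 ≤ k) (n : ℕ) (hn : n = k * (k + 1) / 2) :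
    ∃ α : Fin n → ℝ, (∀ i, Irrational (α i)) ∧ PairwiseIndependent α ∧ kAlpha α = k := by
  have : NeZero k := ⟨by omega⟩
  obtain ⟨Q, hQ⟩ := exists_isDenominatorSeq (show 2 ≤ k by omega)
  obtain ⟨β, hβ, horder⟩ := hQ.exists_family
  have hcard : Fintype.card (Sym2 (ZMod k)) = n := by
    rw [Sym2.card, ZMod.card, Nat.choose_two_right, hn, Nat.add_sub_cancel, mul_comm]
  let e : Fin n ≃ Sym2 (ZMod k) := (Fintype.equivFinOfCardEq hcard).symm
  have hiff : ∀ s, k ≤ s → ∀ t : ℝ, Q s ≤ t → t < Q (s + 1) → ∀ i j,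
      psi (β (e i)) t < psi (β (e j)) t ↔ HitOrder s (e i) (e j) := by
    refine fun s hs t ht ht' i j => ⟨fun h => ?_, horder s hs t ht ht' _ _⟩
    rcases eq_or_ne i j with rfl | hij
    · exact absurd h (lt_irrefl _)
    · exact (HitOrder.trichotomy s (e.injective.ne hij)).resolve_right
        fun h' => h.asymm (horder s hs t ht ht' _ _ h')
  have hinj : ∀ t : ℝ, Q k ≤ t → Function.Injective fun i => psi (β (e i)) t := by
    intro t ht i j hij
    by_contra hne
    obtain ⟨s, hs, hst, hst'⟩ := hQ.exists_stage ht
    rcases HitOrder.trichotomy s (e.injective.ne hne) with h | h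
    · exact (horder s hs t hst hst' _ _ h).ne hij
    · exact (horder s hs t hst hst' _ _ h).ne' hij
  refine ⟨fun i => β (e i), fun i => hβ _, ⟨Q k, by positivity, fun t ht i j hij h =>
    hij (hinj t ht h)⟩, ?_⟩
  rw [kAlpha_eq_card (S := Fin k) _ (fun s i j => HitOrder (s : ℕ) (e i) (e j)) (Q k) hinj,
    Nat.card_fin]
  · intro t ht
    obtain ⟨s, hs, hst, hst'⟩ := hQ.exists_stage ht
    refine ⟨⟨s % k, Nat.mod_lt _ (by omega)⟩, fun i j => ?_⟩
    rw [hiff s hs t hst hst', ← hitOrder_add_mul (s % k) (s / k), Nat.mod_add_div]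
  · intro s T
    obtain ⟨m, hm⟩ := exists_nat_gt T
    have hle : m + 1 ≤ k * (m + 1) := Nat.le_mul_of_pos_left _ (by omega)
    have hle' : k ≤ k * (m + 1) := Nat.le_mul_of_pos_right _ (by omega)
    refine ⟨Q (s + k * (m + 1)), hm.trans ?_, fun i j => ?_⟩
    · have := hQ.strictMono.id_le (s + k * (m + 1))
      simp only [id] at this
      exact_mod_cast (show m < Q (s + k * (m + 1)) by omega)
    · rw [hiff _ (by omega) _ le_rfl (by exact_mod_cast hQ.strictMono (Nat.lt_succ_self _)),
        hitOrder_add_mul]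
  · intro s s' h
    by_contra hne
    have hdiag : Sym2.diag (((s : ℕ) : ZMod k) + 1) ≠ Sym2.diag (((s' : ℕ) : ZMod k) + 1) := by
      intro heq
      have h1 := (ZMod.natCast_eq_natCast_iff' _ _ _).1
        (add_right_cancel (Sym2.diag_injective heq))
      rw [Nat.mod_eq_of_lt s.isLt, Nat.mod_eq_of_lt s'.isLt] at h1
      exact hne (Fin.ext h1)
    have h1 := hitOrder_diag (s : ℕ) hdiag.symm
    have h2 := hitOrder_diag (s' : ℕ) hdiag
    have h3 := congrFun (congrFun h (e.symm (Sym2.diag (((s : ℕ) : ZMod k) + 1))))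
      (e.symm (Sym2.diag (((s' : ℕ) : ZMod k) + 1)))
    simp only [Equiv.apply_symm_apply] at h3
    exact h1.asymm (h3 ▸ h2)
end
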